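/- Let p = 2 and φ an anisotropic quasilinear quadratic form over a field F of characteristic 2 with 2^n + 2^{n−2} < dim φ ≤ 2^{n+1} for some n ≥ 2. If φ has maximal splitting (i.e., i₁(φ) = dim φ − 2^n), then φ is a quasi-Pfister neighbour. -/

import Mathlib

open scoped BigOperators

universe u

variable (p : ℕ)

/-- Defect index of the diagonal quasilinear `p`-form with coefficients `b` over a
commutative ring. -/
noncomputable def defectIdx (K : Type u) [CommRing K] {ι : Type} [Fintype ι]
    (b : ι → K) : ℕ :=
  Module.finrank K (Submodule.span K {x : ι → K | ∑ i, b i * x i ^ p = 0})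

/-- Dehomogenization (on the affine chart `x_d = 1`) of the defining equation of the
projective hypersurface `{Σ bᵢ xᵢ^p = 0}`. -/
noncomputable def ffPoly (K : Type u) [Field K] (d : ℕ) (b : Fin (d + 1) → K) :
    MvPolynomial (Fin d) K :=
  MvPolynomial.C (b (Fin.last d)) +
    ∑ i : Fin d, MvPolynomial.C (b i.castSucc) * MvPolynomial.X i ^ p

/-- The function field `K(φ)` of the projective quasilinear `p`-hypersurface
`X_φ = {Σ bᵢ xᵢ^p = 0}`, realized as the fraction field of the coordinate ring of the
affine chart `x_d = 1` (a variety when `φ` is not completely split). -/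
noncomputable abbrev ffRing (K : Type u) [Field K] (d : ℕ) (b : Fin (d + 1) → K) :
    Type u :=
  FractionRing (MvPolynomial (Fin d) K ⧸ Ideal.span {ffPoly p K d b})

/-- The canonical embedding of `K` into the function field `K(φ)`. -/
noncomputable def ffMap (K : Type u) [Field K] (d : ℕ) (b : Fin (d + 1) → K) :
    K →+* ffRing p K d b :=
  (algebraMap _ _).comp ((Ideal.Quotient.mk (Ideal.span {ffPoly p K d b})).comp
    (MvPolynomial.C : K →+* MvPolynomial (Fin d) K))

/-- The first higher defect index `i₁(φ) = i₀(φ_{K(φ)})`. -/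
noncomputable def i1 (K : Type u) [Field K] (d : ℕ) (b : Fin (d + 1) → K) : ℕ :=
  defectIdx p (ffRing p K d b) (fun i => ffMap p K d b (b i))

/-- Coefficients of the quasi-Pfister form `⟪a₁,…,aₙ⟫ = ⨂ᵢ ⟨1, aᵢ, …, aᵢ^{p-1}⟩`. -/
def pfCoeff {F : Type u} [Field F] {p n : ℕ} (a : Fin n → F) : (Fin n → Fin p) → F :=
  fun e => ∏ i, a i ^ (e i : ℕ)

namespace QL
open MvPolynomial

/-- Type synonym of `F` with scalars acting through squares. -/
def Sq (F : Type u) : Type u := F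

instance (F : Type u) [Field F] : AddCommGroup (Sq F) := inferInstanceAs (AddCommGroup F)

instance sqModule (F : Type u) [Field F] [CharP F 2] : Module F (Sq F) :=
  Module.compHom F (frobenius F 2)

theorem exists_lam {F : Type u} [Field F] [CharP F 2] {ι : Type} [Fintype ι] [DecidableEq ι]
    (e : ι → F)
    (he : ∀ x : ι → F, ∑ i, e i * x i ^ 2 = 0 → x = 0) (i : ι) :
    ∃ l : F →+ F, (∀ s t, l (s ^ 2 * t) = s * l t) ∧ ∀ j, l (e j) = if j = i then 1 else 0 := by
  have hsm : ∀ (s : F) (t : Sq F), s • t = (show Sq F from ((s ^ 2 * (show F from t)) : F)) := by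
    intro s t; rfl
  let e' : ι → Sq F := e
  have hli : LinearIndependent F e' := by
    rw [Fintype.linearIndependent_iff]
    intro g hg j
    have : g = 0 := by
      apply he
      rw [← show (∑ i, g i • e' i) = (0 : F) from hg]
      change _ = ∑ i, (g i ^ 2 * e i : F)
      exact Finset.sum_congr rfl fun _ _ => mul_comm _ _
    rw [this]; rfl
  obtain ⟨f, hf⟩ := LinearMap.exists_extend
    ((Finsupp.lapply i : (ι →₀ F) →ₗ[F] F).comp hli.repr)
  refine ⟨⟨⟨fun x => f (show Sq F from x), f.map_zero⟩, fun x y => f.map_add x y⟩, ?_, ?_⟩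
  · intro s t
    exact f.map_smul s (show Sq F from t)
  · intro j
    change f (e' j) = _
    have := LinearMap.congr_fun hf ⟨e' j, Submodule.subset_span ⟨j, rfl⟩⟩
    simp only [LinearMap.comp_apply, Submodule.subtype_apply] at this
    rw [this]
    rw [Finsupp.lapply_apply, hli.repr_eq_single j ⟨e' j, _⟩ rfl, Finsupp.single_apply]

/-- coefficientwise squaring -/
noncomputable def sh {F : Type u} [Field F] [CharP F 2] (d : ℕ) :
    MvPolynomial (Fin d) F →+* MvPolynomial (Fin d) F := MvPolynomial.map (frobenius F 2)

theorem exists_Lam {F : Type u} [Field F] [CharP F 2] {ι : Type} [Fintype ι] [DecidableEq ι]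
    (e : ι → F) (d : ℕ)
    (he : ∀ x : ι → F, ∑ i, e i * x i ^ 2 = 0 → x = 0) (i : ι) :
    ∃ l : MvPolynomial (Fin d) F →+ MvPolynomial (Fin d) F,
      (∀ s t, l (sh d s * t) = s * l t) ∧ ∀ j, l (C (e j)) = if j = i then 1 else 0 := by
  obtain ⟨l, h1, h2⟩ := exists_lam e he i
  have hmon : ∀ m r, AddMonoidAlgebra.map l (monomial m r : MvPolynomial (Fin d) F)
      = (monomial m (l r) : MvPolynomial (Fin d) F) := fun m r => AddMonoidAlgebra.map_single ..
  have hadd : ∀ x y : MvPolynomial (Fin d) F, (AddMonoidAlgebra.map l (x + y) : MvPolynomial (Fin d) F)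
     = AddMonoidAlgebra.map l x + AddMonoidAlgebra.map l y := fun x y => AddMonoidAlgebra.map_add ..
  refine ⟨AddMonoidHom.mk' (fun x => AddMonoidAlgebra.map l x) hadd, ?_, ?_⟩
  · intro s t
    simp only [AddMonoidHom.mk'_apply]
    induction s using MvPolynomial.induction_on' with
    | monomial m a =>
      induction t using MvPolynomial.induction_on' with
      | monomial n b =>
        rw [sh, map_monomial, monomial_mul, hmon, hmon, monomial_mul, frobenius_def, h1]
      | add p q hp hq => rw [mul_add, hadd, hadd, mul_add, hp, hq]
    | add p q hp hq => rw [map_add, add_mul, hadd, add_mul, hp, hq]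
  · intro j
    simp only [AddMonoidHom.mk'_apply]
    rw [C_apply, hmon, h2]
    split_ifs <;> simp

/-- the linear form `ℓ` -/
noncomputable def ell {F : Type u} [Field F] (d : ℕ) (c : Fin (d + 1) → F) :
    MvPolynomial (Fin d) F :=
  C (c (Fin.last d)) + ∑ i : Fin d, C (c i.castSucc) * X i

theorem sh_ffPoly {F : Type u} [Field F] [CharP F 2] (d : ℕ) (c : Fin (d + 1) → F) :
    sh d (ffPoly 2 F d c) = ell d c * ell d c := by
  rw [← pow_two, ell, ffPoly, CharTwo.add_sq, CharTwo.sum_sq]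
  simp [sh, frobenius_def, mul_pow]

theorem dvd_of_ell_dvd {F : Type u} [Field F] [CharP F 2] (d : ℕ) (c : Fin (d + 1) → F)
    (hc : ∀ x : Fin (d + 1) → F, ∑ i, c i * x i ^ 2 = 0 → x = 0) (a : MvPolynomial (Fin d) F)
    (h : ell d c ∣ sh d a) : ffPoly 2 F d c ∣ a := by
  obtain ⟨g, hg⟩ := h
  obtain ⟨l, h1, h2⟩ := exists_Lam c d hc (Fin.last d)
  have hl : l (ell d c) = 1 := by
    have : ell d c = C (c (Fin.last d)) + ∑ i : Fin d, sh d (X i) * C (c i.castSucc) := by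
      simp [ell, sh, mul_comm]
    rw [this, map_add, map_sum]
    simp only [h1, h2]
    simp [Fin.castSucc_ne_last]
  refine ⟨l g, ?_⟩
  rw [← h1, sh_ffPoly, mul_assoc, ← hg, mul_comm, h1, hl, mul_one]

end QL
namespace QL
theorem field_lemma {L M : Type u} [Field L] [Field M] [Algebra L M] (E H0 : Submodule L M)
    [FiniteDimensional L E]
    (n : ℕ) (hE : Module.finrank L E = 2 ^ n) (h1 : (1 : M) ∈ E)
    (hsq : ∀ y ∈ E, ∃ l : L, y ^ 2 = algebraMap L M l)
    (hH0 : ∀ h ∈ H0, ∀ x ∈ E, h * x ∈ E) (hdim : 2 ^ n < 4 * Module.finrank L H0) :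
    ∀ x ∈ E, ∀ y ∈ E, x * y ∈ E := by
  let H : IntermediateField L M :=
    { carrier := {h | ∀ x ∈ E, h * x ∈ E}
      mul_mem' := fun {a b} ha hb x hx => by rw [mul_assoc]; exact ha _ (hb _ hx)
      add_mem' := fun {a b} ha hb x hx => by rw [add_mul]; exact E.add_mem (ha _ hx) (hb _ hx)
      algebraMap_mem' := fun r x hx => by rw [← Algebra.smul_def]; exact E.smul_mem _ hx
      inv_mem' := fun a ha x hx => by
        have haE : a ∈ E := by simpa using ha 1 h1
        obtain ⟨l, hl⟩ := hsq a haE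
        by_cases h0 : a = 0
        · simp [h0]
        have : a⁻¹ * x = l⁻¹ • (a * x) := by
          rw [Algebra.smul_def, map_inv₀, ← hl]; field_simp
        rw [this]; exact E.smul_mem _ (ha _ hx) }
  have memH : ∀ h : M, h ∈ H ↔ ∀ x ∈ E, h * x ∈ E := fun h => Iff.rfl
  have hHE : ∀ h ∈ H, h ∈ E := fun h hh => by simpa using hh 1 h1
  let E2 : Submodule H M :=
    { carrier := E
      add_mem' := E.add_mem
      zero_mem' := E.zero_mem
      smul_mem' := fun h x hx => h.2 x hx }
  have memE2 : ∀ x, x ∈ E2 ↔ x ∈ E := fun x => Iff.rfl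
  let eqv : E2 ≃ₗ[L] E :=
    { toFun := fun x => ⟨x.1, x.2⟩
      invFun := fun x => ⟨x.1, x.2⟩
      map_add' := fun _ _ => rfl
      map_smul' := fun r x => by
        ext
        simp
      left_inv := fun _ => rfl
      right_inv := fun _ => rfl }
  have hfE2L : Module.finrank L E2 = 2 ^ n := by rw [eqv.finrank_eq, hE]
  have : FiniteDimensional L E2 := eqv.symm.finiteDimensional
  have hfE2 : FiniteDimensional H E2 := FiniteDimensional.right L H E2
  have hfree : Module.Free H E2 := Module.Free.of_divisionRing H E2
  have hmul := Module.finrank_mul_finrank L H E2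
  rw [hfE2L] at hmul
  let incl : H →ₗ[L] E :=
    { toFun := fun x => ⟨x.1, hHE _ x.2⟩
      map_add' := fun _ _ => rfl
      map_smul' := fun r x => by ext; simp }
  have hincl : Function.Injective incl := fun a b hab => by
    have := congrArg Subtype.val hab
    exact Subtype.ext this
  have hfH : FiniteDimensional L H := FiniteDimensional.of_injective incl hincl
  let incl0 : H0 →ₗ[L] H :=
    { toFun := fun x => ⟨x.1, hH0 _ x.2⟩
      map_add' := fun _ _ => rfl
      map_smul' := fun r x => by ext; simp }
  have hincl0 : Function.Injective incl0 := fun a b hab => by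
    have := congrArg Subtype.val hab
    exact Subtype.ext this
  have hle := LinearMap.finrank_le_finrank_of_injective hincl0
  have hr : Module.finrank H E2 ≤ 2 := by
    have hlt : Module.finrank H E2 < 4 := by
      by_contra hcon
      push Not at hcon
      have := Nat.mul_le_mul_left (Module.finrank L H) hcon
      omega
    have hdvd : Module.finrank H E2 ∣ 2 ^ n := ⟨_, by rw [← hmul, mul_comm]⟩
    obtain ⟨k, -, hk⟩ := (Nat.dvd_prime_pow Nat.prime_two).1 hdvd
    rw [hk] at hlt ⊢
    have : k < 2 := by
      by_contra hcon
      push Not at hcon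
      have := Nat.pow_le_pow_right (n := 2) (by norm_num) hcon
      omega
    interval_cases k <;> norm_num
  intro x hx y hy
  by_cases hxH : x ∈ H
  · exact hxH y hy
  have hli : LinearIndependent H ![(1 : M), x] := by
    rw [LinearIndependent.pair_iff]
    intro s t hst
    have ht : t = 0 := by
      by_contra ht
      apply hxH
      have : x = ((-s * t⁻¹ : H) : M) := by
        have ht' : (t : M) ≠ 0 := by simpa using ht
        simp only [IntermediateField.smul_def, smul_eq_mul, mul_one] at hst
        push_cast
        field_simp
        linear_combination hst
      rw [this]; exact Subtype.property _
    subst ht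
    simpa [IntermediateField.smul_def] using hst
  have hspan : Submodule.span H (Set.range ![(1 : M), x]) = E2 := by
    apply Submodule.eq_of_le_of_finrank_le
    · rw [Submodule.span_le]
      rintro _ ⟨i, rfl⟩
      fin_cases i
      · exact h1
      · exact hx
    · rw [finrank_span_eq_card hli]; simpa using hr
  have hy2 : y ∈ Submodule.span H (Set.range ![(1 : M), x]) := by rw [hspan]; exact hy
  simp only [Matrix.range_cons, Matrix.range_empty, Set.union_empty, Set.singleton_union] at hy2
  obtain ⟨a, b, rfl⟩ := Submodule.mem_span_pair.1 hy2
  obtain ⟨l, hl⟩ := hsq x hx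
  have : x * (a • (1 : M) + b • x) = a * x + b * (l • (1 : M)) := by
    rw [IntermediateField.smul_def, IntermediateField.smul_def, Algebra.smul_def l, ← hl,
      smul_eq_mul, smul_eq_mul]
    ring
  rw [this]
  exact E.add_mem (a.2 _ hx) (b.2 _ (E.smul_mem _ h1))

/-- values of the quasi-Pfister form -/
def Pf {F : Type u} [Field F] {r : ℕ} (a : Fin r → F) (x : F) : Prop :=
  ∃ y : (Fin r → Fin 2) → F, ∑ e, pfCoeff a e * y e ^ 2 = x

theorem pf_sum_cons {F : Type u} [Field F] {r : ℕ} (a : Fin r → F) (x : F)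
    (y : (Fin (r + 1) → Fin 2) → F) :
    ∑ e, pfCoeff (Fin.cons x a : Fin (r + 1) → F) e * y e ^ 2 =
      (∑ e, pfCoeff a e * y (Fin.cons 0 e) ^ 2) + x * ∑ e, pfCoeff a e * y (Fin.cons 1 e) ^ 2 := by
  rw [← (Fin.consEquiv (fun _ : Fin (r + 1) => Fin 2)).sum_comp, Fintype.sum_prod_type]
  simp [Fin.sum_univ_two, pfCoeff, Fin.prod_univ_succ, Finset.mul_sum, mul_assoc, Fin.consEquiv]

theorem pf_cons {F : Type u} [Field F] {r : ℕ} (a : Fin r → F) (x z : F) :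
    Pf (Fin.cons x a : Fin (r + 1) → F) z ↔ ∃ u v, Pf a u ∧ Pf a v ∧ z = u + x * v := by
  constructor
  · rintro ⟨y, rfl⟩
    exact ⟨_, _, ⟨_, rfl⟩, ⟨_, rfl⟩, pf_sum_cons a x y⟩
  · rintro ⟨_, _, ⟨y, rfl⟩, ⟨y', rfl⟩, rfl⟩
    refine ⟨fun e => if e 0 = 0 then y (Fin.tail e) else y' (Fin.tail e), ?_⟩
    rw [pf_sum_cons]
    simp

theorem pf_add {F : Type u} [Field F] [CharP F 2] {r : ℕ} (a : Fin r → F) {x z : F}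
    (hx : Pf a x) (hz : Pf a z) : Pf a (x + z) := by
  obtain ⟨y, rfl⟩ := hx
  obtain ⟨y', rfl⟩ := hz
  refine ⟨fun e => y e + y' e, ?_⟩
  simp only [CharTwo.add_sq, mul_add, Finset.sum_add_distrib]

theorem pf_sq_mul {F : Type u} [Field F] {r : ℕ} (a : Fin r → F) {x : F} (s : F)
    (hx : Pf a x) : Pf a (s ^ 2 * x) := by
  obtain ⟨y, rfl⟩ := hx
  refine ⟨fun e => s * y e, ?_⟩
  rw [Finset.mul_sum]
  exact Finset.sum_congr rfl fun _ _ => by ring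

theorem pf_mul {F : Type u} [Field F] [CharP F 2] {r : ℕ} (a : Fin r → F) {x z : F}
    (hx : Pf a x) (hz : Pf a z) : Pf a (x * z) := by
  induction r generalizing x z with
  | zero =>
    obtain ⟨y, rfl⟩ := hx
    obtain ⟨y', rfl⟩ := hz
    refine ⟨fun e => y e * y' e, ?_⟩
    simp [pfCoeff, mul_pow]
  | succ r ih =>
    rw [← Fin.cons_self_tail a] at hx hz ⊢
    rw [pf_cons] at hx hz ⊢
    obtain ⟨u, v, hu, hv, rfl⟩ := hx
    obtain ⟨u', v', hu', hv', rfl⟩ := hz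
    refine ⟨u * u' + a 0 ^ 2 * (v * v'), u * v' + v * u',
      pf_add _ (ih _ hu hu') (pf_sq_mul _ _ (ih _ hv hv')),
      pf_add _ (ih _ hu hv') (ih _ hv hu'), by ring⟩

theorem pf_zero {F : Type u} [Field F] {r : ℕ} (a : Fin r → F) : Pf a 0 := ⟨0, by simp⟩

theorem pf_indep {F : Type u} [Field F] [CharP F 2] {r : ℕ} (a : Fin r → F) {x u v : F}
    (hx : ¬ Pf a x) (hu : Pf a u) (hv : Pf a v) (h : u + x * v = 0) : v = 0 := by
  by_contra hv0
  apply hx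
  have : x = (v⁻¹) ^ 2 * (u * v) := by
    field_simp
    rw [← sub_eq_zero, CharTwo.sub_eq_add, ← h]; ring
  rw [this]
  exact pf_sq_mul _ _ (pf_mul _ hu hv)

theorem exists_pfister {F : Type u} [Field F] [CharP F 2] (E : Set F)
    (h1 : (1 : F) ∈ E) (hmulE : ∀ x ∈ E, ∀ y ∈ E, x * y ∈ E) (n : ℕ)
    (hcard : ∀ (ι : Type) [Fintype ι] (e : ι → F), (∀ i, e i ∈ E) →
      (∀ x : ι → F, ∑ i, e i * x i ^ 2 = 0 → x = 0) → Fintype.card ι ≤ 2 ^ n) :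
    ∃ a : Fin n → F, ∀ x ∈ E, Pf a x := by
  have key : ∀ r : ℕ, (∃ a : Fin r → F, ∀ x ∈ E, Pf a x) ∨
      ∃ a : Fin r → F, (∀ e : Fin r → Fin 2, pfCoeff a e ∈ E) ∧
        ∀ y : (Fin r → Fin 2) → F, ∑ e, pfCoeff a e * y e ^ 2 = 0 → y = 0 := by
    intro r
    induction r with
    | zero =>
      right
      refine ⟨Fin.elim0, fun e => by simpa [pfCoeff] using h1, fun y hy => ?_⟩
      funext e
      rw [Fintype.sum_eq_single e (fun e' he' => absurd (Subsingleton.elim _ _) he')] at hy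
      simpa [pfCoeff] using hy
    | succ r ih =>
      have triv : (∃ a : Fin r → F, ∀ x ∈ E, Pf a x) → (∃ a : Fin (r + 1) → F, ∀ x ∈ E, Pf a x) := by
        rintro ⟨a, ha⟩
        exact ⟨Fin.cons 0 a, fun x hx => (pf_cons _ _ _).2 ⟨x, 0, ha x hx, pf_zero _, by simp⟩⟩
      rcases ih with h | ⟨a, haE, ha⟩
      · exact Or.inl (triv h)
      · by_cases hall : ∀ x ∈ E, Pf a x
        · exact Or.inl (triv ⟨a, hall⟩)
        · push Not at hall
          obtain ⟨x, hxE, hx⟩ := hall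
          right
          refine ⟨Fin.cons x a, ?_, ?_⟩
          · intro e
            have : pfCoeff (Fin.cons x a : Fin (r + 1) → F) e = x ^ (e 0 : ℕ) * pfCoeff a (Fin.tail e) := by
              simp [pfCoeff, Fin.prod_univ_succ, Fin.tail]
            rw [this]
            apply hmulE _ _ _ (haE _)
            generalize e 0 = k
            fin_cases k
            · simpa using h1
            · simpa using hxE
          · intro y hy
            rw [pf_sum_cons] at hy
            have hv := pf_indep a hx ⟨_, rfl⟩ ⟨_, rfl⟩ hy
            rw [hv, mul_zero, add_zero] at hy
            have e1 := ha _ hv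
            have e0 := ha _ hy
            funext e
            rw [← Fin.cons_self_tail e]
            generalize e 0 = k
            fin_cases k
            · exact congrFun e0 (Fin.tail e)
            · exact congrFun e1 (Fin.tail e)
  rcases key n with h | ⟨a, haE, ha⟩
  · exact h
  · refine ⟨a, ?_⟩
    by_contra hall
    push Not at hall
    obtain ⟨x, hxE, hx⟩ := hall
    have := hcard (Option (Fin n → Fin 2)) (fun o => o.elim x (pfCoeff a))
      (by rintro (_ | e); exacts [hxE, haE e])
      (by
        intro y hy
        rw [Fintype.sum_option] at hy
        simp only [Option.elim] at hy
        rw [add_comm] at hy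
        have h1' : Pf a (y none ^ 2) := by
          have h11 : Pf a 1 := ⟨fun e => if e = 0 then 1 else 0, by simp [pfCoeff]⟩
          simpa using pf_sq_mul a (y none) h11
        have hv := pf_indep a hx ⟨_, rfl⟩ h1' hy
        rw [hv, mul_zero, add_zero] at hy
        have e0 := ha _ hy
        funext o
        cases o with
        | none => simpa using hv
        | some e => exact congrFun e0 e)
    simp at this

end QL
namespace QL
open MvPolynomial

theorem clear_den {A L : Type u} [CommRing A] [Field L] (α : A →+* L)
    (hfrac : ∀ x : L, ∃ a b, α b ≠ 0 ∧ α b * x = α a) {κ : Type} [Fintype κ] (x : κ → L) :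
    ∃ b, α b ≠ 0 ∧ ∃ f : κ → A, ∀ k, α b * x k = α (f k) := by
  classical
  choose a b hb hab using hfrac
  refine ⟨∏ k, b (x k), ?_, fun k => (∏ j ∈ Finset.univ.erase k, b (x j)) * a (x k), fun k => ?_⟩
  · rw [map_prod]; exact Finset.prod_ne_zero_iff.2 fun k _ => hb _
  · rw [← Finset.mul_prod_erase _ _ (Finset.mem_univ k), map_mul, map_mul, ← hab]; ring

/-- the evaluation map of the form `e` over `L`, values in `M` -/
noncomputable def T {F L M : Type u} [Field F] [Field L] [Field M] [Algebra L M] {d : ℕ}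
    (β : MvPolynomial (Fin d) F →+* M) {ι : Type} [Fintype ι] (e : ι → F) : (ι → L) →ₗ[L] M :=
  Fintype.linearCombination L (fun i => β (C (e i)))

theorem T_apply {F L M : Type u} [Field F] [Field L] [Field M] [Algebra L M] {d : ℕ}
    (β : MvPolynomial (Fin d) F →+* M) {ι : Type} [Fintype ι] (e : ι → F) (x : ι → L) :
    T β e x = ∑ i, x i • β (C (e i)) := Fintype.linearCombination_apply ..

/-- the colon space -/
noncomputable def Q {F L M : Type u} [Field F] [Field L] [Field M] [Algebra L M] {d : ℕ}
    (c : Fin (d + 1) → F)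
    (β : MvPolynomial (Fin d) F →+* M) {ι : Type} [Fintype ι] (e : ι → F) : Submodule L M where
  carrier := {g | ∀ j, β (C (c j)) * g ∈ LinearMap.range (T (L := L) β e)}
  add_mem' := fun {a b} ha hb j => by rw [mul_add]; exact Submodule.add_mem _ (ha j) (hb j)
  zero_mem' := fun j => by rw [mul_zero]; exact Submodule.zero_mem _
  smul_mem' := fun r x hx j => by rw [mul_smul_comm]; exact Submodule.smul_mem _ _ (hx j)

section
variable {F L M : Type u} [Field F] [CharP F 2] [Field L] [Field M] [Algebra L M] {d : ℕ}
    (c : Fin (d + 1) → F)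
    (α : MvPolynomial (Fin d) F →+* L) (β : MvPolynomial (Fin d) F →+* M)

/-- multiplication by `c_d` embeds the colon space in the value space -/
noncomputable def mulQ {ι : Type} [Fintype ι] (e : ι → F) :
    Q (L := L) c β e →ₗ[L] LinearMap.range (T (L := L) β e) where
  toFun g := ⟨β (C (c (Fin.last d))) * g.1, g.2 _⟩
  map_add' x y := by ext; simp [mul_add]
  map_smul' r x := by ext; simp

theorem mulQ_inj (h0 : β (C (c (Fin.last d))) ≠ 0) {ι : Type} [Fintype ι] (e : ι → F) :
    Function.Injective (mulQ (L := L) c β e) := by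
  intro x y hxy
  have := congrArg Subtype.val hxy
  exact Subtype.ext (mul_left_cancel₀ h0 this)

theorem finrank_ker_le (h0 : β (C (c (Fin.last d))) ≠ 0)
    (hαq : α (ffPoly 2 F d c) = 0)
    (hfrac : ∀ x : L, ∃ a b, α b ≠ 0 ∧ α b * x = α a)
    (hβ : ∀ P, β P = 0 ↔ ell d c ∣ P)
    (hαβ : ∀ a, algebraMap L M (α a) = β (sh d a))
    {ι : Type} [Fintype ι] (e : ι → F)
    (he : ∀ x : ι → F, ∑ i, e i * x i ^ 2 = 0 → x = 0) :
    Module.finrank L (LinearMap.ker (T (L := L) β e)) ≤ Module.finrank L (Q (L := L) c β e) := by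
  classical
  have : FiniteDimensional L (Q (L := L) c β e) :=
    FiniteDimensional.of_injective _ (mulQ_inj c β h0 e)
  set m := Module.finrank L (LinearMap.ker (T (L := L) β e)) with hm
  let b := Module.finBasis L (LinearMap.ker (T (L := L) β e))
  obtain ⟨D, hD, f, hf⟩ := clear_den α hfrac (fun ki : Fin m × ι => (b ki.1).1 ki.2)
  have hrel : ∀ k, ell d c ∣ ∑ i, C (e i) * sh d (f (k, i)) := by
    intro k
    rw [← hβ, map_sum]
    have hk : T (L := L) β e (b k).1 = 0 := (b k).2
    rw [T_apply] at hk
    have := congrArg (fun z => algebraMap L M (α D) * z) hk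
    simp only [mul_zero, Finset.mul_sum] at this
    rw [← this]
    refine Finset.sum_congr rfl fun i _ => ?_
    rw [map_mul, ← hαβ, ← hf, map_mul, Algebra.smul_def]; ring
  choose P hP using hrel
  have hval : ∀ (h : ι → MvPolynomial (Fin d) F),
      β (∑ i, C (e i) * sh d (h i)) ∈ LinearMap.range (T (L := L) β e) := by
    intro h
    refine ⟨fun i => α (h i), ?_⟩
    rw [T_apply, map_sum]
    refine Finset.sum_congr rfl fun i _ => ?_
    rw [map_mul, ← hαβ, Algebra.smul_def]; ring
  have hell : β (ell d c) = 0 := (hβ _).2 dvd_rfl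
  have hQ1 : ∀ k (j : Fin d), β (C (c j.castSucc)) * β (P k) ∈ LinearMap.range (T (L := L) β e) := by
    intro k j
    have hd := congrArg (fun z => β (pderiv j z)) (hP k)
    have h1 : pderiv j (∑ i, C (e i) * sh d (f (k, i))) = ∑ i, C (e i) * sh d (pderiv j (f (k, i))) := by
      rw [map_sum]
      refine Finset.sum_congr rfl fun i _ => ?_
      rw [pderiv_C_mul, sh, pderiv_map, C_mul']
    have h2 : pderiv j (ell d c) = C (c j.castSucc) := by
      simp [ell, pderiv_X, Pi.single_apply, smul_eq_C_mul]
    simp only [h1, pderiv_mul, h2, map_add, map_mul β, hell, zero_mul, add_zero] at hd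
    rw [← hd]
    exact hval _
  have hQ : ∀ k, β (P k) ∈ Q (L := L) c β e := by
    intro k j
    refine Fin.lastCases ?_ (fun j => hQ1 k j) j
    have : β (C (c (Fin.last d))) * β (P k) =
        - ∑ j : Fin d, α (X j) • (β (C (c j.castSucc)) * β (P k)) := by
      rw [eq_neg_iff_add_eq_zero]
      have := congrArg (fun z => z * β (P k)) hell
      simp only [zero_mul, ell, map_add, map_sum, map_mul] at this
      rw [← this, add_mul, Finset.sum_mul]
      congr 1
      refine Finset.sum_congr rfl fun i _ => ?_
      rw [Algebra.smul_def, hαβ, sh, map_X]; ring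
    rw [this]
    exact Submodule.neg_mem _ (Submodule.sum_mem _ fun j _ => Submodule.smul_mem _ _ (hQ1 k j))
  have hli : LinearIndependent L (fun k : Fin m => (⟨β (P k), hQ k⟩ : Q (L := L) c β e)) := by
    rw [Fintype.linearIndependent_iff]
    intro g hg
    obtain ⟨D', hD', a, ha⟩ := clear_den α hfrac g
    have hg1 : ∑ k, g k • β (P k) = 0 := by
      have := congrArg Subtype.val hg
      simpa using this
    have hdv : ell d c ∣ ∑ k, sh d (a k) * P k := by
      rw [← hβ, map_sum]
      have := congrArg (fun z => algebraMap L M (α D') * z) hg1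
      simp only [mul_zero, Finset.mul_sum] at this
      rw [← this]
      refine Finset.sum_congr rfl fun i _ => ?_
      rw [map_mul, ← hαβ, ← ha, map_mul, Algebra.smul_def]; ring
    obtain ⟨h, hh⟩ := hdv
    have hsum : ∑ i, sh d (∑ k, a k * f (k, i)) * C (e i) = sh d (ffPoly 2 F d c) * h := by
      rw [sh_ffPoly, mul_assoc, ← hh, Finset.mul_sum]
      simp only [map_sum, Finset.sum_mul]
      rw [Finset.sum_comm]
      refine Finset.sum_congr rfl fun k _ => ?_
      rw [mul_left_comm, ← hP, Finset.mul_sum]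
      refine Finset.sum_congr rfl fun i _ => ?_
      rw [map_mul]; ring
    have hzero : ∀ i, α (∑ k, a k * f (k, i)) = 0 := by
      intro i
      obtain ⟨l, hl1, hl2⟩ := exists_Lam e d he i
      have := congrArg l hsum
      rw [map_sum, hl1] at this
      simp only [hl1, hl2] at this
      simp only [mul_ite, mul_one, mul_zero, Finset.sum_ite_eq', Finset.mem_univ, if_true] at this
      rw [this, map_mul, hαq, zero_mul]
    have hcomb : ∑ k, g k • b k = 0 := by
      apply Subtype.ext
      funext i
      have h3 := hzero i
      rw [map_sum] at h3
      have h4 : (α D' * α D) * ∑ k, g k * (b k).1 i = 0 := by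
        rw [← h3, Finset.mul_sum]
        refine Finset.sum_congr rfl fun k _ => ?_
        rw [map_mul, ← ha, ← hf]; ring
      have h5 := (mul_eq_zero.1 h4).resolve_left (mul_ne_zero hD' hD)
      simpa [Finset.sum_apply] using h5
    exact Fintype.linearIndependent_iff.1 b.linearIndependent g hcomb
  simpa using hli.fintype_card_le_finrank

theorem core
    (hc : ∀ x : Fin (d + 1) → F, ∑ i, c i * x i ^ 2 = 0 → x = 0)
    (h0 : β (C (c (Fin.last d))) ≠ 0)
    (hαq : α (ffPoly 2 F d c) = 0)
    (hfrac : ∀ x : L, ∃ a b, α b ≠ 0 ∧ α b * x = α a)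
    (hβ : ∀ P, β P = 0 ↔ ell d c ∣ P)
    (hαβ : ∀ a, algebraMap L M (α a) = β (sh d a))
    (n : ℕ) (hn : 2 ≤ n)
    (hdim1 : 2 ^ n + 2 ^ (n - 2) < d + 1)
    (hmax : Module.finrank L (LinearMap.ker (T (L := L) β c)) = (d + 1) - 2 ^ n) :
    ∃ a : Fin (n + 1) → F, ∀ j, Pf a (c j / c (Fin.last d)) := by
  set γ := β (C (c (Fin.last d))) with hγ
  have hM2 : CharP M 2 := charP_of_injective_ringHom (β.comp C).injective 2
  have hβsq : ∀ x : F, β (C x) ^ 2 = algebraMap L M (α (C x)) := by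
    intro x; rw [hαβ, sh, map_C, frobenius_def, C_pow, map_pow]
  set U := LinearMap.range (T (L := L) β c) with hU
  have hUc : ∀ j, β (C (c j)) ∈ U := by
    intro j
    refine ⟨Pi.single j 1, ?_⟩
    rw [T, Fintype.linearCombination_apply_single, one_smul]
  have hUfin : Module.finrank L U = 2 ^ n := by
    have := LinearMap.finrank_range_add_finrank_ker (T (L := L) β c)
    rw [hmax, Module.finrank_fin_fun, ← hU] at this
    have hp := Nat.two_pow_pos (n - 2)
    omega
  -- the space E
  let E : Submodule L M := U.comap (LinearMap.mulLeft L γ)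
  have memE : ∀ x, x ∈ E ↔ γ * x ∈ U := fun x => Iff.rfl
  let eqv : E ≃ₗ[L] U :=
    { toFun := fun x => ⟨γ * x.1, x.2⟩
      invFun := fun x => ⟨γ⁻¹ * x.1, by rw [memE, mul_inv_cancel_left₀ h0]; exact x.2⟩
      map_add' := fun _ _ => by ext; simp [mul_add]
      map_smul' := fun r x => by ext; simp
      left_inv := fun x => by ext; simp [h0]
      right_inv := fun x => by ext; simp [h0] }
  have hEfin : Module.finrank L E = 2 ^ n := by rw [eqv.finrank_eq, hUfin]
  have hEfd : FiniteDimensional L E := eqv.symm.finiteDimensional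
  have h1E : (1 : M) ∈ E := by rw [memE, mul_one]; exact hUc _
  have hsq : ∀ y ∈ E, ∃ l : L, y ^ 2 = algebraMap L M l := by
    intro y hy
    obtain ⟨x, hx⟩ := (memE y).1 hy
    rw [T_apply] at hx
    refine ⟨(∑ i, x i ^ 2 * α (C (c i))) / α (C (c (Fin.last d))), ?_⟩
    have h2 : (γ * y) ^ 2 = algebraMap L M (∑ i, x i ^ 2 * α (C (c i))) := by
      rw [← hx, CharTwo.sum_sq, map_sum]
      refine Finset.sum_congr rfl fun i _ => ?_
      rw [Algebra.smul_def, mul_pow, hβsq, map_mul, map_pow]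
    rw [map_div₀, ← h2, ← hβsq, mul_pow, ← hγ]
    field_simp
  have hmul : ∀ x ∈ E, ∀ y ∈ E, x * y ∈ E := by
    refine field_lemma E (Q (L := L) c β c) n hEfin h1E hsq ?_ ?_
    · intro h hh x hx
      obtain ⟨z, hz⟩ := (memE x).1 hx
      rw [memE, mul_left_comm, ← hz, T_apply, Finset.mul_sum]
      refine Submodule.sum_mem _ fun i _ => ?_
      rw [mul_smul_comm, mul_comm]
      exact Submodule.smul_mem _ _ (hh i)
    · have := finrank_ker_le c α β h0 hαq hfrac hβ hαβ c hc
      rw [hmax] at this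
      have h4 : 2 ^ n = 4 * 2 ^ (n - 2) := by
        obtain ⟨k, rfl⟩ := Nat.exists_eq_add_of_le hn
        rw [Nat.add_sub_cancel_left, pow_add]; norm_num
      omega
  have hcd : c (Fin.last d) ≠ 0 := fun h => h0 (by rw [hγ, h]; simp)
  obtain ⟨a, ha⟩ := exists_pfister (F := F) {x | β (C x) ∈ E} (by simpa using h1E)
    (fun x hx y hy => by
      simp only [Set.mem_ofPred_eq, map_mul] at *
      exact hmul _ hx _ hy) (n + 1)
    (by
      intro ι _ e heE he
      have h3 := finrank_ker_le c α β h0 hαq hfrac hβ hαβ e he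
      have h4 := LinearMap.finrank_le_finrank_of_injective (mulQ_inj (L := L) c β h0 e)
      have h5 := LinearMap.finrank_range_add_finrank_ker (T (L := L) β e)
      rw [Module.finrank_fintype_fun_eq_card] at h5
      have h6 : LinearMap.range (T (L := L) β e) ≤ E := by
        rintro _ ⟨x, rfl⟩
        rw [T_apply]
        exact Submodule.sum_mem _ fun i _ => Submodule.smul_mem _ _ (heE i)
      have h7 := Submodule.finrank_mono h6
      rw [hEfin] at h7
      rw [pow_succ]
      omega)
  refine ⟨a, fun j => ha _ ?_⟩
  rw [Set.mem_ofPred_eq, memE, hγ, ← map_mul, ← C_mul, mul_div_cancel₀ _ hcd]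
  exact hUc j

end

/-- Elimination of the first variable. -/
noncomputable def subst {F : Type u} [Field F] {d : ℕ} (c : Fin (d + 1 + 1) → F) :
    MvPolynomial (Fin (d + 1)) F →ₐ[F] MvPolynomial (Fin (d + 1)) F :=
  aeval (fun i => if i = 0 then X 0 - C (c 0)⁻¹ * ell (d + 1) c else X i)

theorem subst_eq_zero_iff {F : Type u} [Field F] {d : ℕ} (c : Fin (d + 1 + 1) → F) (h : c 0 ≠ 0)
    (P : MvPolynomial (Fin (d + 1)) F) : subst c P = 0 ↔ ell (d + 1) c ∣ P := by
  have hell : subst c (ell (d + 1) c) = 0 := by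
    have hCC : (C (c 0) * C (c 0)⁻¹ : MvPolynomial (Fin (d + 1)) F) = 1 := by
      rw [← C_mul, mul_inv_cancel₀ h, C_1]
    have e1 : subst c (ell (d + 1) c) = C (c (Fin.last _)) +
        (C (c 0) * (X 0 - C (c 0)⁻¹ * ell (d + 1) c) +
          ∑ i : Fin d, C (c i.succ.castSucc) * X i.succ) := by
      conv_lhs => rw [ell]
      simp [subst, Fin.sum_univ_succ, Fin.succ_ne_zero, MvPolynomial.algebraMap_eq,
        MvPolynomial.algHom_C]
    have e2 : ell (d + 1) c = C (c (Fin.last _)) +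
        (C (c 0) * X 0 + ∑ i : Fin d, C (c i.succ.castSucc) * X i.succ) := by
      rw [ell, Fin.sum_univ_succ]; simp
    rw [e1]
    linear_combination (-ell (d + 1) c) * hCC - e2
  constructor
  · intro h
    have : ell (d + 1) c ∣ P - subst c P := by
      rw [← Ideal.mem_span_singleton, ← Ideal.Quotient.eq]
      have : (Ideal.Quotient.mkₐ F (Ideal.span {ell (d + 1) c})) =
          (Ideal.Quotient.mkₐ F (Ideal.span {ell (d + 1) c})).comp (subst c) := by
        apply MvPolynomial.algHom_ext
        intro i
        simp only [AlgHom.comp_apply, subst, aeval_X, Ideal.Quotient.mkₐ_eq_mk]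
        split_ifs with hi
        · subst hi
          rw [Ideal.Quotient.eq, Ideal.mem_span_singleton]
          exact ⟨C (c 0)⁻¹, by ring⟩
        · rfl
      exact congrArg (fun f => f P) this
    simpa [h] using this
  · rintro ⟨g, rfl⟩
    rw [map_mul, hell, zero_mul]

end QL
namespace QL
open MvPolynomial

theorem main (F : Type u) [Field F] [CharP F 2]
    (d : ℕ) (c : Fin (d + 1) → F)
    (haniso : ∀ x : Fin (d + 1) → F, ∑ i, c i * x i ^ 2 = 0 → x = 0)
    (n : ℕ) (hn : 2 ≤ n)
    (hdim1 : 2 ^ n + 2 ^ (n - 2) < d + 1)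
    (hmax : i1 2 F d c = (d + 1) - 2 ^ n) :
    ∃ a : Fin (n + 1) → F, ∀ j, Pf a (c j / c (Fin.last d)) := by
  have hcne : ∀ j, c j ≠ 0 := by
    intro j hj
    have := haniso (Pi.single j 1) (by
      rw [Finset.sum_eq_single j] <;> simp +contextual [hj])
    simpa using congrFun this j
  obtain ⟨d, rfl⟩ : ∃ k, d = k + 1 := by
    cases d with
    | zero => have := Nat.two_pow_pos n; have := Nat.two_pow_pos (n - 2); omega
    | succ k => exact ⟨k, rfl⟩
  let M := FractionRing (MvPolynomial (Fin (d + 1)) F)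
  let β : MvPolynomial (Fin (d + 1)) F →+* M :=
    (algebraMap (MvPolynomial (Fin (d + 1)) F) M).comp (subst c).toRingHom
  have hβ : ∀ P, β P = 0 ↔ ell (d + 1) c ∣ P := by
    intro P
    rw [← subst_eq_zero_iff c (hcne 0)]
    exact map_eq_zero_iff _ (IsFractionRing.injective (MvPolynomial (Fin (d + 1)) F) M)
  have h0 : β (C (c (Fin.last _))) ≠ 0 := by
    intro h
    exact hcne (Fin.last _) ((map_eq_zero (β.comp C)).1 h)
  set I := Ideal.span {ffPoly 2 F (d + 1) c} with hI
  have hker : ∀ a, a ∈ I ↔ β (sh (d + 1) a) = 0 := by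
    intro a
    rw [hβ, hI, Ideal.mem_span_singleton]
    constructor
    · rintro ⟨g, rfl⟩
      rw [map_mul, sh_ffPoly]
      exact ⟨_, by rw [mul_assoc]⟩
    · exact dvd_of_ell_dvd _ c haniso a
  let τ : (MvPolynomial (Fin (d + 1)) F ⧸ I) →+* M :=
    Ideal.Quotient.lift I (β.comp (sh (d + 1))) (fun a ha => (hker a).1 ha)
  have hτ : Function.Injective τ := by
    rw [injective_iff_map_eq_zero]
    intro x hx
    obtain ⟨a, rfl⟩ := Ideal.Quotient.mk_surjective x
    rw [Ideal.Quotient.eq_zero_iff_mem, hker]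
    exact hx
  have : IsDomain (MvPolynomial (Fin (d + 1)) F ⧸ I) := hτ.isDomain τ
  let L := FractionRing (MvPolynomial (Fin (d + 1)) F ⧸ I)
  let σ : L →+* M := IsFractionRing.lift hτ
  let _ : Algebra L M := σ.toAlgebra
  let α : MvPolynomial (Fin (d + 1)) F →+* L :=
    (algebraMap (MvPolynomial (Fin (d + 1)) F ⧸ I) L).comp (Ideal.Quotient.mk I)
  have hαβ : ∀ a, algebraMap L M (α a) = β (sh (d + 1) a) := by
    intro a
    change σ (algebraMap _ L (Ideal.Quotient.mk I a)) = _
    rw [IsFractionRing.lift_algebraMap]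
    rfl
  have hM2 : CharP M 2 := charP_of_injective_ringHom (β.comp C).injective 2
  refine core (L := L) (M := M) c α β haniso h0 ?_ ?_ hβ hαβ n hn hdim1 ?_
  · change algebraMap _ L (Ideal.Quotient.mk I _) = 0
    rw [Ideal.Quotient.eq_zero_iff_mem.2 (Ideal.mem_span_singleton_self _), map_zero]
  · intro x
    obtain ⟨a, b, hb, rfl⟩ := IsFractionRing.div_surjective (MvPolynomial (Fin (d + 1)) F ⧸ I) x
    obtain ⟨a, rfl⟩ := Ideal.Quotient.mk_surjective a
    obtain ⟨b, rfl⟩ := Ideal.Quotient.mk_surjective b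
    have hb2 := IsFractionRing.to_map_ne_zero_of_mem_nonZeroDivisors (K := L) hb
    have hb' : α b ≠ 0 := hb2
    exact ⟨a, b, hb', mul_div_cancel₀ _ hb'⟩
  · rw [← hmax, i1, defectIdx]
    have hset : {x : Fin (d + 1 + 1) → L | ∑ i, ffMap 2 F (d + 1) c (c i) * x i ^ 2 = 0} =
        (LinearMap.ker (T (L := L) β c) : Set (Fin (d + 1 + 1) → L)) := by
      ext x
      have h1 : algebraMap L M (∑ i, ffMap 2 F (d + 1) c (c i) * x i ^ 2) = (T (L := L) β c x) ^ 2 := by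
        rw [T_apply, CharTwo.sum_sq, map_sum]
        refine Finset.sum_congr rfl fun i _ => ?_
        rw [map_mul, map_pow, Algebra.smul_def, mul_pow, mul_comm]
        congr 1
        change algebraMap L M (α (C (c i))) = _
        rw [hαβ, sh, map_C, frobenius_def, C_pow, map_pow]
      change _ = 0 ↔ T (L := L) β c x = 0
      rw [← map_eq_zero (algebraMap L M), h1, sq_eq_zero_iff]
    have hspan : Submodule.span L {x : Fin (d + 1 + 1) → L |
        ∑ i, ffMap 2 F (d + 1) c (c i) * x i ^ 2 = 0} = LinearMap.ker (T (L := L) β c) := by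
      rw [hset, Submodule.span_eq]
    exact (congrArg (fun S : Submodule L (Fin (d + 1 + 1) → L) => Module.finrank L S) hspan).symm

end QL

/-- Let `F` have characteristic `2` and `φ` be an anisotropic quasilinear
quadratic form over `F` with `2^n + 2^{n−2} < dim φ = d + 1 ≤ 2^{n+1}` for some
`n ≥ 2`.  If `φ` has maximal splitting, i.e. `i₁(φ) = dim φ − 2^n`, then `φ` is a
quasi-Pfister neighbour: some scalar multiple `s·φ` (`s ≠ 0`) is isomorphic to a
subform of an `(n+1)`-fold quasi-Pfister form `⟪a₁,…,a_{n+1}⟫` (of dimension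
`2^{n+1}`). -/
theorem stmt19 (F : Type u) [Field F] [CharP F 2]
    (d : ℕ) (c : Fin (d + 1) → F)
    (haniso : ∀ x : Fin (d + 1) → F, ∑ i, c i * x i ^ 2 = 0 → x = 0)
    (n : ℕ) (hn : 2 ≤ n)
    (hdim1 : 2 ^ n + 2 ^ (n - 2) < d + 1) (hdim2 : d + 1 ≤ 2 ^ (n + 1))
    (hmax : i1 2 F d c = (d + 1) - 2 ^ n) :
    ∃ (a : Fin (n + 1) → F) (s : F), s ≠ 0 ∧
      ∃ f : (Fin (d + 1) → F) →ₗ[F] ((Fin (n + 1) → Fin 2) → F),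
        Function.Injective f ∧
        ∀ v : Fin (d + 1) → F,
          ∑ e, pfCoeff a e * (f v) e ^ 2 = s * ∑ i, c i * v i ^ 2 := by
  classical
  have hcne : ∀ j, c j ≠ 0 := by
    intro j hj
    have := haniso (Pi.single j 1) (by
      rw [Finset.sum_eq_single j] <;> simp +contextual [hj])
    simpa using congrFun this j
  obtain ⟨a, ha⟩ := QL.main F d c haniso n hn hdim1 hmax
  choose y hy using ha
  have key : ∀ v : Fin (d + 1) → F,
      ∑ e, pfCoeff a e * (∑ i, v i • y i) e ^ 2 = (c (Fin.last d))⁻¹ * ∑ i, c i * v i ^ 2 := by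
    intro v
    simp only [Finset.sum_apply, Pi.smul_apply, smul_eq_mul, CharTwo.sum_sq, Finset.mul_sum]
    rw [Finset.sum_comm]
    refine Finset.sum_congr rfl fun i _ => ?_
    have := congrArg (fun z => v i ^ 2 * z) (hy i)
    simp only [Finset.mul_sum] at this
    calc _ = ∑ e, v i ^ 2 * (pfCoeff a e * y i e ^ 2) :=
          Finset.sum_congr rfl fun _ _ => by ring
      _ = _ := by rw [this]; ring
  have hap : ∀ v, Fintype.linearCombination F y v = ∑ i, v i • y i :=
    fun v => Fintype.linearCombination_apply ..
  refine ⟨a, (c (Fin.last d))⁻¹, inv_ne_zero (hcne _), Fintype.linearCombination F y, ?_, ?_⟩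
  · rw [injective_iff_map_eq_zero]
    intro v hv
    apply haniso
    have h := key v
    rw [← hap, hv] at h
    simpa [hcne] using h.symm
  · intro v
    rw [hap]
    exact key v
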